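/- Let γ : [0,1] → ℝ² be Lipschitz continuous with Lipschitz constant L ≥ 0, and let r > 0. Then the two-dimensional Lebesgue measure of the open r-neighborhood {x ∈ ℝ² : dist(x, γ([0,1])) < r} of the image of γ is at most 4πr(L + 2r). -/

import Mathlib

open MeasureTheory

/-- The `r`-neighborhood of an `L`-Lipschitz curve over `[0,1]` is covered by the `2r`-balls
centered at `N + 1` equidistant parameters, as soon as `L ≤ r * N`. -/
theorem LipschitzOnWith.thickened_image_subset_iUnion_ball {E : Type*} [PseudoMetricSpace E]
    {γ : ℝ → E} {L : NNReal} (hγ : LipschitzOnWith L γ (Set.Icc 0 1)) {r : ℝ} {N : ℕ}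
    (hN : 0 < N) (hL : (L : ℝ) ≤ r * N) :
    {x : E | Metric.infDist x (γ '' Set.Icc 0 1) < r} ⊆
      ⋃ i ∈ Finset.range (N + 1), Metric.ball (γ (i / N)) (2 * r) := by
  intro x hx
  have hne : (γ '' Set.Icc (0 : ℝ) 1).Nonempty := ⟨γ 0, 0, by simp, rfl⟩
  obtain ⟨_, ⟨t, ht, rfl⟩, hxt⟩ := (Metric.infDist_lt_iff hne).1 hx
  have hN' : (0 : ℝ) < N := by exact_mod_cast hN
  have htN : 0 ≤ t * N := mul_nonneg ht.1 hN'.le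
  have hle : (⌊t * N⌋₊ : ℝ) ≤ t * N := Nat.floor_le htN
  have hlt : t * N < ⌊t * N⌋₊ + 1 := Nat.lt_floor_add_one _
  have hi : (⌊t * N⌋₊ : ℝ) ≤ N := hle.trans (mul_le_of_le_one_left hN'.le ht.2)
  have hmem : (⌊t * N⌋₊ : ℝ) / N ∈ Set.Icc (0 : ℝ) 1 :=
    ⟨by positivity, (div_le_one hN').2 hi⟩
  have hd : dist t (⌊t * N⌋₊ / N) ≤ 1 / N := by
    have h₁ : (⌊t * N⌋₊ : ℝ) / N ≤ t := (div_le_iff₀ hN').2 hle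
    rw [Real.dist_eq, abs_of_nonneg (sub_nonneg.2 h₁), sub_le_iff_le_add, ← add_div,
      le_div_iff₀ hN']
    linarith
  have hγd : dist (γ t) (γ (⌊t * N⌋₊ / N)) ≤ r :=
    calc dist (γ t) (γ (⌊t * N⌋₊ / N)) ≤ L * dist t (⌊t * N⌋₊ / N) := hγ.dist_le_mul t ht _ hmem
      _ ≤ L * (1 / N) := by gcongr
      _ ≤ r := by rw [mul_one_div]; exact (div_le_iff₀ hN').2 hL
  refine Set.mem_biUnion (x := ⌊t * N⌋₊) ?_ ?_
  · exact Finset.mem_coe.2 (Finset.mem_range.2 (Nat.lt_succ_of_le (by exact_mod_cast hi)))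
  · rw [Metric.mem_ball]
    linarith [dist_triangle x (γ t) (γ (⌊t * N⌋₊ / N))]

/-- The two-dimensional Lebesgue measure of the open `r`-neighborhood of the image of a
Lipschitz curve `γ : [0,1] → ℝ²` with Lipschitz constant `L` is at most `4πr(L + 2r)`. -/
theorem measure_thickened_curve_le
    (γ : ℝ → EuclideanSpace ℝ (Fin 2)) (L : NNReal)
    (hγ : LipschitzOnWith L γ (Set.Icc 0 1)) (r : ℝ) (hr : 0 < r) :
    volume {x : EuclideanSpace ℝ (Fin 2) |
        Metric.infDist x (γ '' Set.Icc 0 1) < r} ≤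
      ENNReal.ofReal (4 * Real.pi * r * ((L : ℝ) + 2 * r)) := by
  set N : ℕ := ⌊(L : ℝ) / r⌋₊ + 1 with hN
  have hlt : (L : ℝ) / r < N := by
    rw [hN]
    exact_mod_cast Nat.lt_floor_add_one ((L : ℝ) / r)
  have hle : (N : ℝ) ≤ L / r + 1 := by
    rw [hN]
    push_cast
    gcongr
    exact Nat.floor_le (by positivity)
  have hL : (L : ℝ) ≤ r * N := by
    rw [mul_comm]
    exact ((div_lt_iff₀ hr).1 hlt).le
  have hball (i : ℕ) : volume (Metric.ball (γ (i / N)) (2 * r)) =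
      ENNReal.ofReal ((2 * r) ^ 2 * Real.pi) := by
    rw [EuclideanSpace.volume_ball_fin_two, ← ENNReal.ofReal_pow (by positivity),
      ← ENNReal.ofReal_mul (by positivity)]
  calc _ ≤ volume (⋃ i ∈ Finset.range (N + 1), Metric.ball (γ (i / N)) (2 * r)) :=
        measure_mono (hγ.thickened_image_subset_iUnion_ball (Nat.succ_pos _) hL)
    _ ≤ ∑ i ∈ Finset.range (N + 1), volume (Metric.ball (γ (i / N)) (2 * r)) :=
        measure_biUnion_finset_le _ _
    _ = ENNReal.ofReal ((N + 1 : ℕ) * ((2 * r) ^ 2 * Real.pi)) := by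
        simp only [hball, Finset.sum_const, Finset.card_range, nsmul_eq_mul]
        rw [ENNReal.ofReal_mul (Nat.cast_nonneg _), ENNReal.ofReal_natCast]
    _ ≤ ENNReal.ofReal ((L / r + 2) * ((2 * r) ^ 2 * Real.pi)) := by
        gcongr
        push_cast
        linarith
    _ = ENNReal.ofReal (4 * Real.pi * r * ((L : ℝ) + 2 * r)) := by
        congr 1
        field_simp
        ring
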